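/- Let P be a pattern of length k ≥ 1 over {0,1}, let S be a binary string of length n, and let β ≥ 3 be an integer with β·k ≤ n. For each i ∈ [n], let I_i = {(i+s) mod n : 0 ≤ s < βk} be the cyclic window of length βk starting at i, and let h(I_i) denote the minimum size of a set H ⊆ [n] such that every copy of P in S at a position l with {l, l+1, …, l+k−1} ⊆ I_i contains an element of H (i.e., l + j ∈ H for some j ∈ [k]). Then (β−2)·k·h_P(S) ≤ Σ_{i=0}^{n−1} h(I_i) ≤ β·k·h_P(S). -/

import Mathlib

/-- The string `S` of length `n` contains a copy of the pattern `P` of length `k`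
at position `l`. -/
def HasCopy1 (n k : ℕ) (S P : ℕ → Bool) (l : ℕ) : Prop :=
  l + k ≤ n ∧ ∀ j < k, S (l + j) = P j

/-- The hitting number `h_P(S)`: the minimum size of a set `H ⊆ [n]` intersecting
every copy of `P` in `S`. -/
noncomputable def hitNum1 (n k : ℕ) (S P : ℕ → Bool) : ℕ :=
  sInf {m : ℕ | ∃ H : Set ℕ, H ⊆ {i : ℕ | i < n} ∧ H.Finite ∧ H.ncard = m ∧
    ∀ l : ℕ, HasCopy1 n k S P l → ∃ j : ℕ, j < k ∧ l + j ∈ H}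

/-- `z` belongs to the cyclic window `I_i = {(i+s) mod n : 0 ≤ s < β·k}` of length
`β·k` starting at `i`. -/
def InWindow (n k β i z : ℕ) : Prop :=
  ∃ s : ℕ, s < β * k ∧ z = (i + s) % n

/-- `h(I_i)`: the minimum size of a set `H ⊆ [n]` hitting every copy of `P` in `S`
lying entirely inside the cyclic window `I_i`. -/
noncomputable def winHitNum (n k β : ℕ) (S P : ℕ → Bool) (i : ℕ) : ℕ :=
  sInf {m : ℕ | ∃ H : Set ℕ, H ⊆ {z : ℕ | z < n} ∧ H.Finite ∧ H.ncard = m ∧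
    ∀ l : ℕ, HasCopy1 n k S P l → (∀ j < k, InWindow n k β i (l + j)) →
      ∃ j : ℕ, j < k ∧ l + j ∈ H}

/-- Greedy packing: every finite set of integers contains a `k`-separated subset `D` such that
each element lies within distance less than `k` to the right of an element of `D`. -/
theorem exists_separated_dominating_subset {k : ℕ} (hk : 1 ≤ k) (C : Finset ℕ) :
    ∃ D ⊆ C, (∀ d ∈ D, ∀ e ∈ D, d < e → d + k ≤ e) ∧ ∀ c ∈ C, ∃ d ∈ D, d ≤ c ∧ c < d + k := by
  induction C using Finset.strongInduction with
  | H C ih =>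
    rcases C.eq_empty_or_nonempty with rfl | hC
    · exact ⟨∅, by simp⟩
    · obtain ⟨m, hm, hle⟩ : ∃ m ∈ C, ∀ c ∈ C, m ≤ c := ⟨C.min' hC, C.min'_mem hC, C.min'_le⟩
      obtain ⟨D, hDC, hsep, hdom⟩ := ih (C.filter (m + k ≤ ·)) (by
        refine Finset.filter_ssubset.2 ⟨m, hm, by omega⟩)
      have hD : ∀ d ∈ D, d ∈ C ∧ m + k ≤ d := fun d hd => by simpa using hDC hd
      refine ⟨insert m D, ?_, ?_, ?_⟩
      · intro d hd
        rcases Finset.mem_insert.1 hd with rfl | hd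
        · exact hm
        · exact (hD d hd).1
      · intro d hd e he hde
        rw [Finset.mem_insert] at hd he
        rcases hd with rfl | hd <;> rcases he with rfl | he
        · omega
        · exact (hD e he).2
        · have := (hD d hd).2
          omega
        · exact hsep d hd e he hde
      · intro c hc
        by_cases h : m + k ≤ c
        · obtain ⟨d, hd, h'⟩ := hdom c (by simp [hc, h])
          exact ⟨d, Finset.mem_insert_of_mem hd, h'⟩
        · exact ⟨m, Finset.mem_insert_self _ _, hle c hc, by omega⟩

/-- A finite set meeting each of a family of pairwise disjoint intervals of length `k` is at least
as large as the family. -/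
theorem card_le_ncard_of_hits {k : ℕ} {D : Finset ℕ} {H : Set ℕ} (hH : H.Finite)
    (hsep : ∀ d ∈ D, ∀ e ∈ D, d < e → d + k ≤ e) (hhit : ∀ d ∈ D, ∃ j, j < k ∧ d + j ∈ H) :
    D.card ≤ H.ncard := by
  choose! f hfk hfH using hhit
  rw [← Set.ncard_coe_finset]
  refine Set.ncard_le_ncard_of_injOn (fun d => d + f d) (fun d hd => hfH d hd) ?_ hH
  intro d hd e he hde
  have hd' := hfk d hd
  have he' := hfk e he
  simp only at hde
  rcases lt_trichotomy d e with h | h | h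
  · have := hsep d hd e he h
    omega
  · exact h
  · have := hsep e he d hd h
    omega

/-- The hitting number is at most the size of some family of pairwise disjoint copies. -/
theorem exists_disjoint_copies (n k : ℕ) (hk : 1 ≤ k) (S P : ℕ → Bool) :
    ∃ D : Finset ℕ, (∀ d ∈ D, HasCopy1 n k S P d) ∧
      (∀ d ∈ D, ∀ e ∈ D, d < e → d + k ≤ e) ∧ hitNum1 n k S P ≤ D.card := by
  classical
  obtain ⟨D, hDC, hsep, hdom⟩ := exists_separated_dominating_subset hk
    ((Finset.range n).filter (HasCopy1 n k S P))
  have hD : ∀ d ∈ D, HasCopy1 n k S P d := fun d hd => (Finset.mem_filter.1 (hDC hd)).2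
  refine ⟨D, hD, hsep, ?_⟩
  suffices h : hitNum1 n k S P ≤ (D.image (· + (k - 1))).card from h.trans Finset.card_image_le
  refine Nat.sInf_le ⟨(D.image (· + (k - 1)) : Finset ℕ), ?_, Finset.finite_toSet _,
    Set.ncard_coe_finset _, ?_⟩
  · intro x hx
    obtain ⟨d, hd, rfl⟩ := Finset.mem_image.1 hx
    have := (hD d hd).1
    simp only [Set.mem_ofPred_eq]
    omega
  · intro l hl
    have := hl.1
    obtain ⟨d, hd, h1, h2⟩ := hdom l (Finset.mem_filter.2 ⟨Finset.mem_range.2 (by omega), hl⟩)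
    exact ⟨d + (k - 1) - l, by omega, Finset.mem_image.2 ⟨d, hd, by omega⟩⟩

/-- A window hitting number is at least the number of disjoint copies inside the window. -/
theorem card_le_winHitNum {n k β i : ℕ} (hk : 1 ≤ k) {S P : ℕ → Bool} {D : Finset ℕ}
    (hD : ∀ d ∈ D, HasCopy1 n k S P d) (hsep : ∀ d ∈ D, ∀ e ∈ D, d < e → d + k ≤ e)
    (hwin : ∀ d ∈ D, ∀ j < k, InWindow n k β i (d + j)) :
    D.card ≤ winHitNum n k β S P i := by
  refine le_csInf ⟨_, {z | z < n}, subset_rfl, Set.finite_lt_nat n, rfl, ?_⟩ ?_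
  · intro l hl _
    have := hl.1
    exact ⟨0, by omega, by simp only [Set.mem_ofPred_eq]; omega⟩
  · rintro _ ⟨H, -, hH, rfl, hhit⟩
    exact card_le_ncard_of_hits hH hsep fun d hd => hhit d (hD d hd) (hwin d hd)

/-- Some finite set of size `hitNum1 n k S P` hits all copies. -/
theorem exists_hitting_set (n k : ℕ) (hk : 1 ≤ k) (S P : ℕ → Bool) :
    ∃ H : Finset ℕ, (∀ z ∈ H, z < n) ∧ H.card = hitNum1 n k S P ∧
      ∀ l, HasCopy1 n k S P l → ∃ j, j < k ∧ l + j ∈ H := by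
  have hne : {m : ℕ | ∃ H : Set ℕ, H ⊆ {i : ℕ | i < n} ∧ H.Finite ∧ H.ncard = m ∧
      ∀ l : ℕ, HasCopy1 n k S P l → ∃ j : ℕ, j < k ∧ l + j ∈ H}.Nonempty := by
    refine ⟨_, {z | z < n}, subset_rfl, Set.finite_lt_nat n, rfl, fun l hl => ?_⟩
    have := hl.1
    exact ⟨0, by omega, by simp only [Set.mem_ofPred_eq]; omega⟩
  obtain ⟨H, hHn, hH, hcard, hhit⟩ := Nat.sInf_mem hne
  lift H to Finset ℕ using hH
  rw [Set.ncard_coe_finset] at hcard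
  exact ⟨H, fun z hz => hHn hz, hcard, hhit⟩

open Classical in
/-- A position lies in at most `β * k` cyclic windows. -/
theorem card_windows_mem_le {n k β z : ℕ} (hβk : β * k ≤ n) (hz : z < n) :
    ((Finset.range n).filter fun i => InWindow n k β i z).card ≤ β * k := by
  calc _ ≤ ((Finset.range (β * k)).image fun s => (z + n - s) % n).card := ?_
    _ ≤ β * k := Finset.card_image_le.trans (Finset.card_range _).le
  refine Finset.card_le_card fun i hi => ?_
  obtain ⟨hin, s, hs, rfl⟩ := Finset.mem_filter.1 hi
  rw [Finset.mem_range] at hin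
  refine Finset.mem_image.2 ⟨s, Finset.mem_range.2 hs, ?_⟩
  rcases lt_or_ge (i + s) n with h | h
  · rw [Nat.mod_eq_of_lt h, show i + s + n - s = i + n by omega, Nat.add_mod_right,
      Nat.mod_eq_of_lt hin]
  · rw [Nat.mod_eq_sub_mod h, Nat.mod_eq_of_lt (a := i + s - n) (by omega),
      show i + s - n + n - s = i by omega, Nat.mod_eq_of_lt hin]

open Classical in
/-- An interval of length `k` inside `[n]` lies in at least `(β - 2) * k` cyclic windows. -/
theorem le_card_windows_contain {n k β l : ℕ} (hβ : 2 ≤ β) (hβk : β * k ≤ n) (hl : l + k ≤ n) :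
    (β - 2) * k ≤
      ((Finset.range n).filter fun i => ∀ j < k, InWindow n k β i (l + j)).card := by
  obtain ⟨b, rfl⟩ := Nat.exists_eq_add_of_le hβ
  rw [Nat.add_sub_cancel_left]
  rw [add_mul] at hβk
  have hinj : Set.InjOn (fun s => (l + n - s) % n) (Finset.range (b * k)) := by
    intro s hs t ht hst
    simp only [Finset.coe_range, Set.mem_Iio] at hs ht
    have hst : l + n - s ≡ l + n - t [MOD n] := hst
    have hadd := hst.add_right (s + t)
    rw [show l + n - s + (s + t) = l + n + t by omega,
      show l + n - t + (s + t) = l + n + s by omega] at hadd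
    exact ((Nat.ModEq.add_left_cancel' _ hadd).eq_of_lt_of_lt (by omega) (by omega)).symm
  calc b * k = ((Finset.range (b * k)).image fun s => (l + n - s) % n).card := by
        rw [Finset.card_image_of_injOn hinj, Finset.card_range]
    _ ≤ _ := Finset.card_le_card fun i hi => ?_
  obtain ⟨s, hs, rfl⟩ := Finset.mem_image.1 hi
  rw [Finset.mem_range] at hs
  refine Finset.mem_filter.2 ⟨Finset.mem_range.2 (Nat.mod_lt _ (by omega)), fun j hj => ?_⟩
  refine ⟨s + j, by rw [add_mul]; omega, ?_⟩
  rw [Nat.mod_add_mod, show l + n - s + (s + j) = l + j + n by omega, Nat.add_mod_right,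
    Nat.mod_eq_of_lt (by omega)]

/-- The sum over all `i ∈ [n]` of the window hitting numbers `h(I_i)` is between
`(β-2)·k·h_P(S)` and `β·k·h_P(S)`. -/
theorem stmt19 (n k β : ℕ) (hk : 1 ≤ k) (hβ : 3 ≤ β) (hβk : β * k ≤ n)
    (P S : ℕ → Bool) :
    (β - 2) * k * hitNum1 n k S P ≤ ∑ i ∈ Finset.range n, winHitNum n k β S P i ∧
    ∑ i ∈ Finset.range n, winHitNum n k β S P i ≤ β * k * hitNum1 n k S P := by
  classical
  constructor
  · obtain ⟨D, hD, hsep, hle⟩ := exists_disjoint_copies n k hk S P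
    calc (β - 2) * k * hitNum1 n k S P ≤ D.card * ((β - 2) * k) := by
          rw [mul_comm]; gcongr
      _ ≤ ∑ d ∈ D,
          ((Finset.range n).filter fun i => ∀ j < k, InWindow n k β i (d + j)).card := by
          rw [← smul_eq_mul]
          exact Finset.card_nsmul_le_sum _ _ _ fun d hd =>
            le_card_windows_contain (by omega) hβk (hD d hd).1
      _ = ∑ i ∈ Finset.range n,
          (D.filter fun d => ∀ j < k, InWindow n k β i (d + j)).card :=
          Finset.sum_card_bipartiteAbove_eq_sum_card_bipartiteBelow
            fun d i => ∀ j < k, InWindow n k β i (d + j)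
      _ ≤ _ := Finset.sum_le_sum fun i _ => card_le_winHitNum hk
          (fun d hd => hD d (Finset.mem_filter.1 hd).1)
          (fun d hd e he => hsep d (Finset.mem_filter.1 hd).1 e (Finset.mem_filter.1 he).1)
          (fun d hd => (Finset.mem_filter.1 hd).2)
  · obtain ⟨H, hHn, hcard, hhit⟩ := exists_hitting_set n k hk S P
    calc _ ≤ ∑ i ∈ Finset.range n, (H.filter fun z => InWindow n k β i z).card := by
          refine Finset.sum_le_sum fun i _ => Nat.sInf_le
            ⟨(H.filter fun z => InWindow n k β i z : Finset ℕ), fun z hz =>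
              hHn z (Finset.mem_filter.1 hz).1, Finset.finite_toSet _,
              Set.ncard_coe_finset _, fun l hl hwin => ?_⟩
          obtain ⟨j, hj, hjH⟩ := hhit l hl
          exact ⟨j, hj, Finset.mem_filter.2 ⟨hjH, hwin j hj⟩⟩
      _ = ∑ z ∈ H, ((Finset.range n).filter fun i => InWindow n k β i z).card :=
          Finset.sum_card_bipartiteAbove_eq_sum_card_bipartiteBelow fun i z => InWindow n k β i z
      _ ≤ H.card * (β * k) := by
          rw [← smul_eq_mul]
          exact Finset.sum_le_card_nsmul _ _ _ fun z hz => card_windows_mem_le hβk (hHn z hz)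
      _ = _ := by rw [hcard, mul_comm]
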